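/- The geometric realization of the alpha complex A(X)_r is homotopy equivalent to the union of closed balls of radius r centered at the points of X. -/

import Mathlib

noncomputable section

abbrev Pt := EuclideanSpace ℝ (Fin 2)

/-- The Voronoi cell of `x` with respect to the point set `X`. -/
def Vor (X : Finset Pt) (x : Pt) : Set Pt := {p | ∀ y ∈ X, dist p x ≤ dist p y}

/-- `R_x(r) = B_x(r) ∩ V_x`, a closed convex set. -/
def RCell (X : Finset Pt) (x : Pt) (r : ℝ) : Set Pt := Metric.closedBall x r ∩ Vor X x

/-- The alpha complex `A(X)_r`: the nerve of the cover `{R_x(r)}_{x ∈ X}`. -/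
def AlphaCpx (X : Finset Pt) (r : ℝ) : Set (Finset Pt) :=
  {σ | σ.Nonempty ∧ (σ : Set Pt) ⊆ (X : Set Pt) ∧ (⋂ x ∈ σ, RCell X x r).Nonempty}

open scoped RealInnerProductSpace

/-- The points of `X` nearest to `q`. -/
def nearestPts (X : Finset Pt) (q : Pt) : Set Pt := {x | x ∈ X ∧ q ∈ Vor X x}

/-- The union of the closed balls of radius `r` around the points of `X`. -/
abbrev ballUnion (X : Finset Pt) (r : ℝ) : Set Pt := ⋃ x ∈ X, Metric.closedBall x r

/-- The geometric realization of the alpha complex. -/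
abbrev alphaShape (X : Finset Pt) (r : ℝ) : Set Pt :=
  ⋃ σ ∈ AlphaCpx X r, convexHull ℝ (σ : Set Pt)

lemma mem_ballUnion {X : Finset Pt} {r : ℝ} {p : Pt} :
    p ∈ ballUnion X r ↔ ∃ x ∈ X, dist p x ≤ r := by
  simp [ballUnion]

lemma convex_setOf_inner_le (v : Pt) (c : ℝ) : Convex ℝ {x : Pt | c ≤ ⟪x, v⟫} := by
  have h : IsLinearMap ℝ fun x : Pt => ⟪x, v⟫ :=
    ⟨fun x y => inner_add_left x y v, fun a x => by simp [inner_smul_left]⟩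
  exact convex_halfSpace_ge h c

/-- The relation "`f` is in the convex hull of the points of `X` nearest to `q`" is monotone. -/
lemma inner_nonneg_of_mem_convexHull_nearestPts {X : Finset Pt} {q q' f f' : Pt}
    (h : f ∈ convexHull ℝ (nearestPts X q)) (h' : f' ∈ convexHull ℝ (nearestPts X q')) :
    0 ≤ ⟪f - f', q - q'⟫ := by
  have key : ∀ x ∈ nearestPts X q, ∀ x' ∈ nearestPts X q', ⟪x', q - q'⟫ ≤ ⟪x, q - q'⟫ := by
    rintro x ⟨hx, hxq⟩ x' ⟨hx', hxq'⟩
    have h1 := pow_le_pow_left₀ dist_nonneg (hxq x' hx') 2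
    have h2 := pow_le_pow_left₀ dist_nonneg (hxq' x hx) 2
    simp only [dist_eq_norm, norm_sub_sq_real] at h1 h2
    simp only [inner_sub_right, real_inner_comm q, real_inner_comm q'] at *
    linarith
  have key' : ∀ x' ∈ nearestPts X q', ⟪x', q - q'⟫ ≤ ⟪f, q - q'⟫ := fun x' hx' =>
    convexHull_min (fun x hx => key x hx x' hx') (convex_setOf_inner_le _ _) h
  have := convexHull_min (t := {x : Pt | ⟪f, q' - q⟫ ≤ ⟪x, q' - q⟫}) (fun x' hx' => by
    have := key' x' hx'
    simp only [inner_sub_right, Set.mem_ofPred_eq] at *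
    linarith) (convex_setOf_inner_le _ _) h'
  simp only [inner_sub_right, inner_sub_left, Set.mem_ofPred_eq] at *
  linarith

/-- If `f` is in the hull of the points nearest to `q`, and `q` is in the union of balls, then `f`
is in the alpha shape. -/
lemma mem_alphaShape_of_mem_ballUnion {X : Finset Pt} {r : ℝ} {q f : Pt}
    (hf : f ∈ convexHull ℝ (nearestPts X q)) (hq : q ∈ ballUnion X r) :
    f ∈ alphaShape X r := by
  classical
  obtain ⟨y, hy, hqy⟩ := mem_ballUnion.1 hq
  have hcoe : ((X.filter fun x => q ∈ Vor X x : Finset Pt) : Set Pt) = nearestPts X q := by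
    ext; simp [nearestPts]
  have hmem : (X.filter fun x => q ∈ Vor X x) ∈ AlphaCpx X r := by
    refine ⟨?_, ?_, q, ?_⟩
    · rw [← Finset.coe_nonempty, hcoe]
      exact convexHull_nonempty_iff.1 ⟨f, hf⟩
    · rw [hcoe]
      exact fun x hx => hx.1
    · simp only [Set.mem_iInter, Finset.mem_filter]
      rintro x ⟨hx, hqx⟩
      exact ⟨(hqx y hy).trans hqy, hqx⟩
  exact Set.mem_biUnion hmem (by rwa [hcoe])

lemma exists_center_of_mem_alphaShape {X : Finset Pt} {r : ℝ} {p : Pt} (hp : p ∈ alphaShape X r) :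
    ∃ o, p ∈ convexHull ℝ (nearestPts X o) ∧ ∀ x ∈ nearestPts X o, dist o x ≤ r := by
  simp only [alphaShape, Set.mem_iUnion] at hp
  obtain ⟨σ, ⟨⟨z, hz⟩, hσX, o, ho⟩, hp⟩ := hp
  simp only [Set.mem_iInter] at ho
  have hsub : (σ : Set Pt) ⊆ nearestPts X o := fun x hx => ⟨hσX hx, (ho x hx).2⟩
  refine ⟨o, convexHull_mono hsub hp, fun x hx => ?_⟩
  exact (hx.2 z (hσX hz)).trans (ho z hz).1

/-- The resolvent equation: every point is a convex combination, with prescribed ratio, of some `q`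
and a point in the hull of the points nearest to `q`. -/
lemma exists_resolvent {X : Finset Pt} (hX : X.Nonempty) {M : ℝ} (hM : 0 < M) (p : Pt) :
    ∃ q f, f ∈ convexHull ℝ (nearestPts X q) ∧ f + M • q = (1 + M) • p := by
  classical
  set L : Finset (Pt × ℝ) := X.image fun x => (x, ‖x‖ ^ 2) with hL
  obtain ⟨⟨f, w⟩, hfw, hmin⟩ := (L.finite_toSet.isCompact_convexHull (𝕜 := ℝ)).exists_isMinOn
    ((convexHull_nonempty_iff (𝕜 := ℝ)).2 (by simpa [hL] using hX))
    (f := fun z : Pt × ℝ => ‖z.1 - (1 + M) • p‖ ^ 2 + M * z.2) (by fun_prop)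
  set q : Pt := M⁻¹ • ((1 + M) • p - f) with hq
  have hMq : M • q = (1 + M) • p - f := smul_inv_smul₀ hM.ne' _
  refine ⟨q, f, ?_, by rw [hMq]; abel⟩
  have hvar : ∀ x ∈ X, w - 2 * ⟪f, q⟫ ≤ ‖x‖ ^ 2 - 2 * ⟪x, q⟫ := by
    intro x hx
    have hxL : (x, ‖x‖ ^ 2) ∈ convexHull ℝ (L : Set (Pt × ℝ)) :=
      subset_convexHull ℝ _ (Finset.mem_coe.2 (Finset.mem_image_of_mem _ hx))
    have hineq : ∀ t ∈ Set.Ioo (0 : ℝ) 1,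
        0 ≤ M * (‖x‖ ^ 2 - w - 2 * ⟪x - f, q⟫) + t * ‖x - f‖ ^ 2 := by
      rintro t ⟨ht0, ht1⟩
      have hmem := (convex_convexHull ℝ (L : Set (Pt × ℝ))) hfw hxL
        (sub_nonneg.2 ht1.le) ht0.le (by ring)
      have h := isMinOn_iff.1 hmin _ hmem
      simp only [Prod.smul_mk, Prod.mk_add_mk, smul_eq_mul] at h
      have e1 : (1 - t) • f + t • x - (1 + M) • p = t • (x - f) - M • q := by
        rw [hMq]; module
      have e2 : f - (1 + M) • p = -(M • q) := by rw [hMq]; abel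
      rw [e1, e2, norm_neg, norm_sub_sq_real, norm_smul t, Real.norm_of_nonneg ht0.le,
        inner_smul_left, inner_smul_right, conj_trivial] at h
      have h' : 0 ≤ t * (M * (‖x‖ ^ 2 - w - 2 * ⟪x - f, q⟫) + t * ‖x - f‖ ^ 2) := by
        linear_combination h
      exact nonneg_of_mul_nonneg_right h' ht0
    have hlim : 0 ≤ M * (‖x‖ ^ 2 - w - 2 * ⟪x - f, q⟫) := by
      have ht : Filter.Tendsto
          (fun t : ℝ => M * (‖x‖ ^ 2 - w - 2 * ⟪x - f, q⟫) + t * ‖x - f‖ ^ 2)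
          (nhdsWithin 0 (Set.Ioi 0))
          (nhds (M * (‖x‖ ^ 2 - w - 2 * ⟪x - f, q⟫) + 0 * ‖x - f‖ ^ 2)) :=
        ((by fun_prop : Continuous fun t : ℝ =>
          M * (‖x‖ ^ 2 - w - 2 * ⟪x - f, q⟫) + t * ‖x - f‖ ^ 2).tendsto 0).mono_left
            nhdsWithin_le_nhds
      rw [zero_mul, add_zero] at ht
      exact ge_of_tendsto ht (Filter.eventually_of_mem (Ioo_mem_nhdsGT one_pos) hineq)
    have := nonneg_of_mul_nonneg_right hlim hM
    rw [inner_sub_left] at this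
    linarith
  obtain ⟨c, hc0, hc1, hc⟩ := Finset.mem_convexHull.1 hfw
  have hinj : Set.InjOn (fun x : Pt => (x, ‖x‖ ^ 2)) X := fun x _ y _ h => congrArg Prod.fst h
  set d : Pt → ℝ := fun x => c (x, ‖x‖ ^ 2) with hd
  have hd0 : ∀ x ∈ X, 0 ≤ d x := fun x hx => hc0 _ (Finset.mem_image_of_mem _ hx)
  rw [hL, Finset.sum_image hinj] at hc1
  rw [Finset.centerMass_eq_of_sum_1 _ _ (by rw [hL, Finset.sum_image hinj, hc1]),
    hL, Finset.sum_image hinj] at hc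
  have hf : ∑ x ∈ X, d x • x = f := by
    simpa [Prod.fst_sum] using congrArg Prod.fst hc
  have hw : ∑ x ∈ X, d x * ‖x‖ ^ 2 = w := by
    simpa [Prod.snd_sum] using congrArg Prod.snd hc
  have hsum : ∑ x ∈ X, d x * (‖x‖ ^ 2 - 2 * ⟪x, q⟫ - (w - 2 * ⟪f, q⟫)) = 0 := by
    have hfq : ∑ x ∈ X, d x * ⟪x, q⟫ = ⟪f, q⟫ := by
      rw [← hf, sum_inner]
      simp [inner_smul_left]
    calc _ = ∑ x ∈ X, d x * ‖x‖ ^ 2 - 2 * ∑ x ∈ X, d x * ⟪x, q⟫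
          - (∑ x ∈ X, d x) * (w - 2 * ⟪f, q⟫) := by
          rw [Finset.mul_sum, Finset.sum_mul, ← Finset.sum_sub_distrib, ← Finset.sum_sub_distrib]
          exact Finset.sum_congr rfl fun x _ => by ring
      _ = 0 := by rw [hw, hfq, hc1]; ring
  have hzero := (Finset.sum_eq_zero_iff_of_nonneg fun x hx =>
    mul_nonneg (hd0 x hx) (sub_nonneg.2 (hvar x hx))).1 hsum
  rw [← hf, ← Finset.sum_filter_of_ne (p := fun x => d x ≠ 0)
    (fun x _ h hx => h (by rw [hx, zero_smul]))]
  refine (convex_convexHull ℝ _).sum_mem (fun x hx => hd0 x (Finset.mem_filter.1 hx).1)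
    (by rw [Finset.sum_filter_ne_zero]; exact hc1) fun x hx => subset_convexHull ℝ _ ?_
  obtain ⟨hx, hdx⟩ := Finset.mem_filter.1 hx
  refine ⟨hx, fun y hy => ?_⟩
  have h1 := (mul_eq_zero.1 (hzero x hx)).resolve_left hdx
  have h2 := hvar y hy
  refine le_of_sq_le_sq ?_ dist_nonneg
  simp only [dist_eq_norm, norm_sub_sq_real, real_inner_comm _ q] at *
  linarith

/-- Stability of the resolvent equation. -/
lemma norm_sub_le_of_resolvent {X : Finset Pt} {q q' f f' p p' : Pt} {M M' : ℝ} (hM : 0 ≤ M)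
    (hf : f ∈ convexHull ℝ (nearestPts X q)) (hf' : f' ∈ convexHull ℝ (nearestPts X q'))
    (h : f + M • q = (1 + M) • p) (h' : f' + M' • q' = (1 + M') • p') :
    ‖f - f'‖ ≤ (1 + M) * ‖p - p'‖ + |M - M'| * ‖p' - q'‖ := by
  have hmono := inner_nonneg_of_mem_convexHull_nearestPts hf hf'
  have e : (f - f') + M • (q - q') = (1 + M) • (p - p') + (M - M') • (p' - q') := by
    rw [eq_sub_of_add_eq h, eq_sub_of_add_eq h']
    module
  calc ‖f - f'‖ ≤ ‖(f - f') + M • (q - q')‖ := by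
        refine le_of_sq_le_sq ?_ (norm_nonneg _)
        rw [norm_add_sq_real, inner_smul_right]
        nlinarith [mul_nonneg hM hmono, sq_nonneg ‖M • (q - q')‖]
    _ ≤ ‖(1 + M) • (p - p')‖ + ‖(M - M') • (p' - q')‖ := by
        rw [e]
        exact norm_add_le _ _
    _ = _ := by
        rw [norm_smul, norm_smul, Real.norm_of_nonneg (by linarith), Real.norm_eq_abs]

/-- If `p` is in the hull of the points nearest to `o`, then moving from `o` to a point closer
to `p` does not leave the union of balls. -/
lemma mem_ballUnion_of_norm_sub_le {X : Finset Pt} {r : ℝ} {p q o : Pt}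
    (hpo : p ∈ convexHull ℝ (nearestPts X o)) (hor : ∀ x ∈ nearestPts X o, dist o x ≤ r)
    (hq : ‖p - q‖ ^ 2 ≤ ‖p - o‖ ^ 2) : q ∈ ballUnion X r := by
  rw [mem_ballUnion]
  by_contra! hcon
  have hsub : nearestPts X o ⊆ {x : Pt | ‖x - o‖ ^ 2 < ‖x - q‖ ^ 2} := fun x hx => by
    have := (hor x hx).trans_lt (hcon x hx.1)
    rw [dist_comm, dist_comm q, dist_eq_norm, dist_eq_norm] at this
    exact pow_lt_pow_left₀ this (norm_nonneg _) two_ne_zero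
  have hconv : Convex ℝ {x : Pt | ‖x - o‖ ^ 2 < ‖x - q‖ ^ 2} := by
    have : {x : Pt | ‖x - o‖ ^ 2 < ‖x - q‖ ^ 2} =
        {x : Pt | (‖o‖ ^ 2 - ‖q‖ ^ 2) / 2 < ⟪x, o - q⟫} := by
      ext x
      simp only [Set.mem_ofPred_eq, norm_sub_sq_real, inner_sub_right]
      constructor <;> intro <;> linarith
    rw [this]
    exact convex_halfSpace_gt (f := fun x : Pt => ⟪x, o - q⟫)
      ⟨fun x y => inner_add_left x y _, fun a x => by simp [inner_smul_left]⟩ _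
  exact absurd (convexHull_min hsub hconv hpo) (not_lt.2 hq)

/-- On the alpha shape, all resolvents stay in the alpha shape. -/
lemma exists_resolvent_of_mem_alphaShape {X : Finset Pt} {r M : ℝ} (hM : 0 ≤ M) {p : Pt}
    (hp : p ∈ alphaShape X r) :
    ∃ q f, f ∈ convexHull ℝ (nearestPts X q) ∧ f + M • q = (1 + M) • p ∧ ‖p - q‖ ≤ r ∧
      f ∈ alphaShape X r := by
  obtain ⟨o, hpo, hor⟩ := exists_center_of_mem_alphaShape hp
  have hpor : ‖p - o‖ ≤ r := by
    have := convexHull_min (t := Metric.closedBall o r)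
      (fun x hx => by rw [Metric.mem_closedBall']; exact hor x hx) (convex_closedBall o r) hpo
    rwa [mem_closedBall_iff_norm] at this
  obtain rfl | hM := hM.eq_or_lt
  · exact ⟨o, p, hpo, by simp, hpor, hp⟩
  have hne : (nearestPts X o).Nonempty := convexHull_nonempty_iff.1 ⟨p, hpo⟩
  obtain ⟨q, f, hf, h⟩ := exists_resolvent ⟨_, hne.some_mem.1⟩ hM p
  have hmono := inner_nonneg_of_mem_convexHull_nearestPts hpo hf
  have e : p - f = M • (q - p) := by
    rw [eq_sub_of_add_eq h]
    module
  have hle : ‖p - q‖ ^ 2 ≤ ‖p - o‖ ^ 2 := by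
    rw [e, inner_smul_left, conj_trivial] at hmono
    have hmono := nonneg_of_mul_nonneg_right hmono hM
    have : p - o = (p - q) - (o - q) := by abel
    have h2 : q - p = -(p - q) := by abel
    rw [this, norm_sub_sq_real (p - q)]
    rw [h2, inner_neg_left] at hmono
    nlinarith [sq_nonneg ‖o - q‖]
  refine ⟨q, f, hf, h, (le_of_sq_le_sq hle (norm_nonneg _)).trans hpor,
    mem_alphaShape_of_mem_ballUnion hf (mem_ballUnion_of_norm_sub_le hpo hor hle)⟩

/-- Enlarging the radius slightly does not change which Voronoi faces meet the union of balls. -/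
lemma exists_pos_forall_mem_alphaShape (X : Finset Pt) (r : ℝ) :
    ∃ ε > 0, ∀ q ∈ ballUnion X (r + ε), ∀ f ∈ convexHull ℝ (nearestPts X q),
      f ∈ alphaShape X r := by
  classical
  have key : ∀ σ ∈ X.powerset, ∀ᶠ ε in nhdsWithin (0 : ℝ) (Set.Ioi 0),
      ∀ q ∈ ballUnion X (r + ε), nearestPts X q = σ → ∀ f ∈ convexHull ℝ (σ : Set Pt),
        f ∈ alphaShape X r := by
    intro σ hσ
    by_cases hA : σ ∈ AlphaCpx X r
    · exact Filter.Eventually.of_forall fun ε q _ _ f hf => Set.mem_biUnion hA hf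
    obtain rfl | ⟨x, hx⟩ := σ.eq_empty_or_nonempty
    · exact Filter.Eventually.of_forall fun ε q _ _ f hf => by simp at hf
    set K : Set Pt := ⋂ x ∈ σ, Vor X x with hK
    have hKclosed : IsClosed K := by
      refine isClosed_biInter fun x _ => ?_
      simp only [Vor, Set.ofPred_forall]
      exact isClosed_biInter fun y _ => isClosed_le (by fun_prop) (by fun_prop)
    have hKσ : ∀ q, nearestPts X q = σ → q ∈ K := fun q hq => by
      simp only [hK, Set.mem_iInter]
      exact fun z hz => ((Set.ext_iff.1 hq z).2 hz).2
    obtain hKe | hKne := K.eq_empty_or_nonempty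
    · exact Filter.Eventually.of_forall fun ε q _ hq => by simpa [hKe] using hKσ q hq
    obtain ⟨o, ho, hox⟩ := hKclosed.exists_infDist_eq_dist hKne x
    have hXx : x ∈ X := Finset.mem_powerset.1 hσ hx
    have ho' : ∀ z ∈ σ, o ∈ Vor X z := by simpa [hK] using ho
    have hro : r < dist x o := by
      by_contra! hle
      refine hA ⟨⟨x, hx⟩, Finset.coe_subset.2 (Finset.mem_powerset.1 hσ), o, ?_⟩
      simp only [Set.mem_iInter]
      exact fun z hz => ⟨(ho' z hz x hXx).trans (by rwa [dist_comm]), ho' z hz⟩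
    filter_upwards [Ioo_mem_nhdsGT (sub_pos.2 hro)] with ε hε q hq hqσ
    obtain ⟨y, hy, hqy⟩ := mem_ballUnion.1 hq
    have h1 : dist q x ≤ dist q y := ((Set.ext_iff.1 hqσ x).2 hx).2 y hy
    have h2 : dist x o ≤ dist x q := hox ▸ Metric.infDist_le_dist_of_mem (hKσ q hqσ)
    rw [dist_comm x q] at h2
    linarith [hε.2]
  obtain ⟨ε, hε, hε0⟩ := (((Finset.eventually_all _).2 key).and self_mem_nhdsWithin).exists
  refine ⟨ε, hε0, fun q hq f hf => ?_⟩
  have hcoe : nearestPts X q = (X.filter fun x => q ∈ Vor X x : Finset Pt) := by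
    ext; simp [nearestPts]
  exact hε _ (Finset.mem_powerset.2 (Finset.filter_subset _ _)) q hq hcoe f (hcoe ▸ hf)

/-- A resolvent of a point moves it closer to each of its nearest points. -/
lemma dist_resolvent_le {X : Finset Pt} {q f p y : Pt} {M : ℝ} (hM : 0 < M)
    (hf : f ∈ convexHull ℝ (nearestPts X q)) (h : f + M • q = (1 + M) • p)
    (hy : y ∈ nearestPts X p) : dist f y ≤ dist p y := by
  have hmono := inner_nonneg_of_mem_convexHull_nearestPts hf (subset_convexHull ℝ _ hy)
  have e : p - f = M • (q - p) := by
    rw [eq_sub_of_add_eq h]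
    module
  have hpos : 0 ≤ ⟪f - y, p - f⟫ := by
    rw [e, inner_smul_right]
    exact mul_nonneg hM.le hmono
  rw [dist_eq_norm, dist_eq_norm]
  refine le_of_sq_le_sq ?_ (norm_nonneg _)
  rw [show p - y = (f - y) + (p - f) by abel, norm_add_sq_real]
  nlinarith [sq_nonneg ‖p - f‖]

lemma exists_nearestPts_dist_le {X : Finset Pt} {r : ℝ} {p : Pt} (hp : p ∈ ballUnion X r) :
    ∃ y ∈ nearestPts X p, dist p y ≤ r := by
  obtain ⟨x, hx, hpx⟩ := mem_ballUnion.1 hp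
  obtain ⟨y, hy, hmin⟩ := X.exists_min_image (dist p) ⟨x, hx⟩
  exact ⟨y, ⟨hy, hmin⟩, (hmin x hx).trans hpx⟩

lemma alphaShape_subset_ballUnion (X : Finset Pt) (r : ℝ) :
    alphaShape X r ⊆ ballUnion X r := by
  intro p hp
  obtain ⟨o, hpo, hor⟩ := exists_center_of_mem_alphaShape hp
  exact mem_ballUnion_of_norm_sub_le hpo hor (by simp)

/-- The points of the union of balls have resolvents in the alpha shape, for a suitable parameter,
and are joined to these by segments in the union of balls. -/
lemma exists_resolvent_of_mem_ballUnion (X : Finset Pt) {r : ℝ} (hr : 0 ≤ r) :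
    ∃ M : ℝ, 0 < M ∧ ∀ p ∈ ballUnion X r, ∃ q f, f ∈ convexHull ℝ (nearestPts X q) ∧
      f + M • q = (1 + M) • p ∧ f ∈ alphaShape X r ∧ segment ℝ p f ⊆ ballUnion X r := by
  obtain ⟨ε, hε, hA⟩ := exists_pos_forall_mem_alphaShape X r
  refine ⟨2 * r / ε + 1, by positivity, fun p hp => ?_⟩
  set M : ℝ := 2 * r / ε + 1 with hM
  have hM0 : 0 < M := by positivity
  obtain ⟨y, hy, hpy⟩ := exists_nearestPts_dist_le hp
  obtain ⟨q, f, hf, h⟩ := exists_resolvent ⟨y, hy.1⟩ hM0 p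
  have hfy := (dist_resolvent_le hM0 hf h hy).trans hpy
  refine ⟨q, f, hf, h, hA q (mem_ballUnion.2 ⟨y, hy.1, ?_⟩) f hf, ?_⟩
  · have e : p - f = M • (q - p) := by
      rw [eq_sub_of_add_eq h]
      module
    have hpf : M * dist q p ≤ 2 * r := by
      rw [dist_eq_norm, ← Real.norm_of_nonneg hM0.le, ← norm_smul, ← e, ← dist_eq_norm]
      linarith [dist_triangle_right p f y]
    have hMε : 2 * r ≤ M * ε := by
      rw [hM, add_mul, div_mul_cancel₀ _ hε.ne']
      linarith
    have := le_of_mul_le_mul_left (hpf.trans hMε) hM0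
    linarith [dist_triangle q p y]
  · exact ((convex_closedBall y r).segment_subset hpy hfy).trans
      (Set.subset_biUnion_of_mem (u := fun x => Metric.closedBall x r) hy.1)

/-- The geometric realization of the alpha complex (the union of the convex hulls of its
simplices, which are geometric simplices on `X ⊆ ℝ²`) is homotopy equivalent to the union
of the closed balls of radius `r` centered at the points of `X`.  This is an instance of
the Nerve theorem for finite collections of closed convex sets in Euclidean space. -/
theorem alphaCpx_homotopyEquiv_union_balls (X : Finset Pt) (r : ℝ) (hr : 0 ≤ r) :
    Nonempty
      (ContinuousMap.HomotopyEquiv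
        (⋃ σ ∈ AlphaCpx X r, convexHull ℝ (σ : Set Pt) : Set Pt)
        (⋃ x ∈ X, Metric.closedBall x r : Set Pt)) := by
  obtain ⟨M, hM, hU⟩ := exists_resolvent_of_mem_ballUnion X hr
  choose! Q F hFQ hres hFS hseg using hU
  have hS : ∀ z : unitInterval × alphaShape X r, ∃ q f, f ∈ convexHull ℝ (nearestPts X q) ∧
      f + (M * z.1) • q = (1 + M * z.1) • (z.2 : Pt) ∧ ‖(z.2 : Pt) - q‖ ≤ r ∧
      f ∈ alphaShape X r := fun z =>
    exists_resolvent_of_mem_alphaShape (mul_nonneg hM.le z.1.2.1) z.2.2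
  choose q G hGq hGres hqr hGS using hS
  have hsub := alphaShape_subset_ballUnion X r
  have hFcont : Continuous fun p : ballUnion X r => F p := by
    refine LipschitzWith.continuous (K := (1 + M).toNNReal) (LipschitzWith.of_dist_le_mul ?_)
    intro p p'
    rw [Real.coe_toNNReal _ (by positivity), dist_eq_norm, Subtype.dist_eq, dist_eq_norm]
    simpa using norm_sub_le_of_resolvent hM.le (hFQ p p.2) (hFQ p' p'.2)
      (hres p p.2) (hres p' p'.2)
  have hGcont : Continuous G := by
    refine continuous_iff_continuousAt.2 fun z => tendsto_iff_dist_tendsto_zero.2 ?_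
    have hb : Continuous fun y : unitInterval × alphaShape X r =>
        (1 + M * y.1) * ‖(y.2 : Pt) - z.2‖ + |M * (y.1 : ℝ) - M * z.1| * ‖(z.2 : Pt) - q z‖ := by
      fun_prop
    refine squeeze_zero (fun _ => dist_nonneg) (fun y => ?_) (by simpa using hb.tendsto z)
    rw [dist_eq_norm]
    exact norm_sub_le_of_resolvent (mul_nonneg hM.le y.1.2.1) (hGq y) (hGq z) (hGres y) (hGres z)
  have hG0 : ∀ p, G (0, p) = p := fun p => by simpa using hGres (0, p)
  have hG1 : ∀ p, G (1, p) = F p := fun p => by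
    have hp := hsub p.2
    have h1 := hGres (1, p)
    simp only [Set.Icc.coe_one, mul_one] at h1
    have := norm_sub_le_of_resolvent hM.le (hGq (1, p)) (hFQ p hp) h1 (hres p hp)
    simpa [sub_eq_zero] using this
  refine ⟨⟨⟨Set.inclusion hsub, continuous_inclusion hsub⟩,
    ⟨fun p => ⟨F p, hFS p p.2⟩, hFcont.subtype_mk _⟩, ?_, ?_⟩⟩
  · refine ContinuousMap.Homotopic.symm ⟨⟨⟨fun z => ⟨G z, hGS z⟩, hGcont.subtype_mk _⟩, ?_, ?_⟩⟩
    · exact fun p => Subtype.ext (hG0 p)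
    · exact fun p => Subtype.ext (hG1 p)
  · refine ContinuousMap.Homotopic.symm ⟨⟨⟨fun z =>
      ⟨AffineMap.lineMap (z.2 : Pt) (F z.2) (z.1 : ℝ), hseg z.2 z.2.2 ?_⟩, ?_⟩, ?_, ?_⟩⟩
    · rw [segment_eq_image_lineMap]
      exact ⟨z.1, z.1.2, rfl⟩
    · refine Continuous.subtype_mk ?_ _
      have := hFcont.comp (continuous_snd (X := unitInterval))
      simp only [AffineMap.lineMap_apply_module]
      exact ((by fun_prop : Continuous fun z : unitInterval × ballUnion X r =>
        (1 - (z.1 : ℝ)) • (z.2 : Pt))).add ((continuous_subtype_val.comp continuous_fst).smul this)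
    · exact fun p => Subtype.ext (AffineMap.lineMap_apply_zero _ _)
    · exact fun p => Subtype.ext (AffineMap.lineMap_apply_one _ _)
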